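/- For all positive integers n ≥ 8 and d ≥ 1, the number of prime numbers p satisfying n^d < p ≤ n^(d+1) is at least n^(d − (log d)/2), where log denotes the natural logarithm and n^(d − (log d)/2) denotes a real power. -/

import Mathlib

open Real in
/-- Chebyshev's bound `θ x ≤ x log 4`, with the primes up to `x ^ (2 / 3)` counted trivially. -/
theorem primeCounting_le_rpow_two_thirds_add {x : ℝ} (hx : 1 < x) :
    (Nat.primeCounting ⌊x⌋₊ : ℝ) ≤ x ^ (2 / 3 : ℝ) + 3 * log 2 * x / log x := by
  have hlog : 0 < log x := log_pos hx
  set y : ℝ := x ^ (2 / 3 : ℝ) with hy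
  have hy0 : 0 < y := by positivity
  have hlogy : log y = 2 / 3 * log x := log_rpow (by linarith) _
  have hcount : ((Nat.primeCounting ⌊x⌋₊ : ℝ) - y) * log y ≤ log 4 * x := by
    have hsmall : (((Finset.Ioc 0 ⌊x⌋₊).filter Nat.Prime).card : ℝ) ≤
        ((((Finset.Ioc 0 ⌊x⌋₊).filter Nat.Prime).filter fun p : ℕ => y < (p : ℝ)).card : ℝ) + y := by
      rw [← Finset.card_filter_add_card_filter_not (s := (Finset.Ioc 0 ⌊x⌋₊).filter Nat.Prime)
        (fun p : ℕ => y < (p : ℝ))]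
      push_cast
      have : ((((Finset.Ioc 0 ⌊x⌋₊).filter Nat.Prime).filter fun p : ℕ => ¬ y < (p : ℝ)).card : ℝ)
          ≤ (⌊y⌋₊ : ℝ) := by
        have hsub : (((Finset.Ioc 0 ⌊x⌋₊).filter Nat.Prime).filter fun p : ℕ => ¬ y < (p : ℝ)) ⊆
            Finset.Ioc 0 ⌊y⌋₊ := by
          intro p hp
          simp only [Finset.mem_filter, Finset.mem_Ioc, not_lt] at hp ⊢
          exact ⟨hp.1.1.1, Nat.le_floor hp.2⟩
        have := Finset.card_le_card hsub
        rw [Nat.card_Ioc] at this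
        exact_mod_cast this
      linarith [Nat.floor_le hy0.le]
    have hcard : Nat.primeCounting ⌊x⌋₊ = ((Finset.Ioc 0 ⌊x⌋₊).filter Nat.Prime).card := by
      rw [Nat.primeCounting, Nat.primeCounting', Nat.count_eq_card_filter_range]
      congr 1
      ext p
      simp only [Finset.mem_filter, Finset.mem_range, Finset.mem_Ioc]
      exact ⟨fun h => ⟨⟨h.2.pos, by omega⟩, h.2⟩, fun h => ⟨by omega, h.2⟩⟩
    have hlogy0 : 0 ≤ log y := by rw [hlogy]; positivity
    calc ((Nat.primeCounting ⌊x⌋₊ : ℝ) - y) * log y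
        ≤ ((((Finset.Ioc 0 ⌊x⌋₊).filter Nat.Prime).filter fun p : ℕ => y < (p : ℝ)).card : ℝ)
            * log y := by
          rw [hcard]
          exact mul_le_mul_of_nonneg_right (by linarith) hlogy0
      _ = ∑ p ∈ (((Finset.Ioc 0 ⌊x⌋₊).filter Nat.Prime).filter fun p : ℕ => y < (p : ℝ)), log y := by
          rw [Finset.sum_const, nsmul_eq_mul]
      _ ≤ ∑ p ∈ (((Finset.Ioc 0 ⌊x⌋₊).filter Nat.Prime).filter fun p : ℕ => y < (p : ℝ)),
            log (p : ℝ) := by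
          refine Finset.sum_le_sum fun p hp => log_le_log hy0 ?_
          exact (Finset.mem_filter.1 hp).2.le
      _ ≤ Chebyshev.theta x := by
          refine Finset.sum_le_sum_of_subset_of_nonneg (Finset.filter_subset _ _) ?_
          intro p hp _
          exact log_natCast_nonneg p
      _ ≤ log 4 * x := Chebyshev.theta_le_log4_mul_x (by linarith)
  have hlog4 : log 4 = 2 * log 2 := by
    rw [show (4 : ℝ) = 2 ^ 2 by norm_num, log_pow]; norm_num
  rw [hlogy, hlog4] at hcount
  rw [← sub_le_iff_le_add', le_div_iff₀ hlog]
  linarith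

open Real in
/-- Reduction of `n ^ (d - log d / 2) ≤ π (n ^ (d + 1)) - π (n ^ d)` to an upper bound for
`π (n ^ d)`. -/
theorem rpow_le_card_primes_of_primeCounting_le {n d : ℕ} (hn : 8 ≤ n) (hd : 1 ≤ d)
    (h : (d + 1) * log n * ((n : ℝ) ^ d / d + 2 + Nat.primeCounting (n ^ d)) ≤
      n * (n : ℝ) ^ d * log 2) :
    (n : ℝ) ^ ((d : ℝ) - log d / 2) ≤
      ((Finset.Ioc (n ^ d) (n ^ (d + 1))).filter Nat.Prime).card := by
  have hn' : (8 : ℝ) ≤ n := by exact_mod_cast hn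
  have hd' : (1 : ℝ) ≤ d := by exact_mod_cast hd
  have hn0 : (0 : ℝ) < n := by linarith
  have hd0 : (0 : ℝ) < d := by linarith
  have ht : 2 ≤ log n := by
    have h8 : log 8 = 3 * log 2 := by
      rw [show (8 : ℝ) = 2 ^ 3 by norm_num, log_pow]; norm_num
    have := log_le_log (by norm_num) hn'
    have := log_two_gt_d9
    linarith
  have hpow : (n : ℝ) ^ ((d : ℝ) - log d / 2) ≤ (n : ℝ) ^ d / d := by
    rw [rpow_sub hn0, rpow_natCast]
    refine div_le_div_of_nonneg_left (by positivity) hd0 ?_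
    rw [rpow_def_of_pos hn0]
    calc (d : ℝ) = exp (log d) := (exp_log hd0).symm
      _ ≤ exp (log n * (log d / 2)) := exp_le_exp.2 (by nlinarith [log_nonneg hd'])
  have hcard : Nat.primeCounting (n ^ (d + 1)) ≤ Nat.primeCounting (n ^ d) +
      ((Finset.Ioc (n ^ d) (n ^ (d + 1))).filter Nat.Prime).card := by
    simp only [Nat.primeCounting, Nat.primeCounting', Nat.count_eq_card_filter_range]
    refine le_trans (Finset.card_le_card ?_) (Finset.card_union_le _ _)
    intro p hp
    simp only [Finset.mem_filter, Finset.mem_range, Finset.mem_union, Finset.mem_Ioc] at hp ⊢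
    by_cases hpn : p < n ^ d + 1
    · exact Or.inl ⟨hpn, hp.2⟩
    · exact Or.inr ⟨⟨by omega, by omega⟩, hp.2⟩
  have hcard' : (Nat.primeCounting (n ^ (d + 1)) : ℝ) ≤ Nat.primeCounting (n ^ d) +
      ((Finset.Ioc (n ^ d) (n ^ (d + 1))).filter Nat.Prime).card := by exact_mod_cast hcard
  have hlow := Chebyshev.pi_ge (n ^ (d + 1))
  push_cast at hlow
  set N : ℝ := (n : ℝ) ^ (d + 1) with hN
  have hNn : (2 : ℝ) ≤ N := by
    have : (n : ℝ) ≤ N := le_self_pow₀ (by linarith) (by omega)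
    linarith
  have hlogN : log N = (d + 1) * log n := by rw [hN, log_pow]; push_cast; ring
  have hlogN0 : 0 < log N := log_pos (by linarith)
  have hlogN1 : log (N + 1) ≤ 2 * log N := by
    rw [← log_rpow (by linarith)]
    exact log_le_log (by linarith) (by rw [rpow_two]; nlinarith)
  rw [div_le_iff₀ hlogN0] at hlow
  have hN' : n * (n : ℝ) ^ d = N := by rw [hN, pow_succ]; ring
  rw [← hlogN, hN'] at h
  have : (n : ℝ) ^ d / d + 2 + Nat.primeCounting (n ^ d) ≤
      Nat.primeCounting (n ^ (d + 1)) + 2 := by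
    refine le_of_mul_le_mul_left ?_ hlogN0
    linarith
  linarith

open Real in
/-- The tangent line bound for `log` at `8`. -/
theorem log_le_div_eight_add {x : ℝ} (hx : 0 < x) : log x ≤ x / 8 - 1 + 3 * log 2 := by
  have h := log_le_sub_one_of_pos (show 0 < x / 8 by positivity)
  rw [log_div hx.ne' (by norm_num), show (8 : ℝ) = 2 ^ 3 by norm_num, log_pow] at h
  push_cast at h
  linarith

open Real in
/-- The tangent line bound for `log` at `16`. -/
theorem log_le_div_sixteen_add {x : ℝ} (hx : 0 < x) : log x ≤ x / 16 - 1 + 4 * log 2 := by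
  have h := log_le_sub_one_of_pos (show 0 < x / 16 by positivity)
  rw [log_div hx.ne' (by norm_num), show (16 : ℝ) = 2 ^ 4 by norm_num, log_pow] at h
  push_cast at h
  linarith

/-- Every prime above `6` is coprime to `6`, which bounds their density by `φ 6 / 6 = 1 / 3`. -/
theorem primeCounting_le_div_three_add {m : ℕ} (hm : 6 ≤ m) :
    (Nat.primeCounting m : ℝ) ≤ m / 3 + 3 := by
  have h := Nat.primeCounting'_add_le (a := 6) (k := 7) (by norm_num) (by norm_num) (m - 6)
  rw [show 7 + (m - 6) = m + 1 by omega, show Nat.totient 6 = 2 by decide,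
    show Nat.primeCounting' 7 = 3 by decide] at h
  have h' : 3 * Nat.primeCounting m ≤ m + 9 := by
    unfold Nat.primeCounting
    omega
  have : (3 : ℝ) * Nat.primeCounting m ≤ m + 9 := by exact_mod_cast h'
  linarith

/-- Every prime above `30` is coprime to `30`, which bounds their density by
`φ 30 / 30 = 4 / 15`. -/
theorem primeCounting_le_four_div_fifteen_mul_add {m : ℕ} (hm : 30 ≤ m) :
    (Nat.primeCounting m : ℝ) ≤ 4 / 15 * m + 18 := by
  have h := Nat.primeCounting'_add_le (a := 30) (k := 31) (by norm_num) (by norm_num) (m - 30)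
  rw [show 31 + (m - 30) = m + 1 by omega, show Nat.totient 30 = 8 by decide,
    show Nat.primeCounting' 31 = 10 by decide] at h
  have h' : 15 * Nat.primeCounting m ≤ 4 * m + 270 := by
    unfold Nat.primeCounting
    omega
  have : (15 : ℝ) * Nat.primeCounting m ≤ 4 * m + 270 := by exact_mod_cast h'
  linarith

/-- Among two consecutive numbers above `2` at most one is prime. -/
theorem primeCounting_le_half {m : ℕ} (hm : 8 ≤ m) : (Nat.primeCounting m : ℝ) ≤ m / 2 := by
  have h' : 2 * Nat.primeCounting m ≤ m := by
    induction m using Nat.strong_induction_on with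
    | _ m ih =>
      rcases Nat.lt_or_ge m 10 with h | h
      · interval_cases m <;> decide
      · have := ih (m - 2) (by omega) (by omega)
        have h2 : Nat.primeCounting m ≤ Nat.primeCounting (m - 2) + 1 := by
          obtain ⟨k, rfl⟩ : ∃ k, m = k + 2 := ⟨m - 2, by omega⟩
          simp only [Nat.primeCounting, Nat.primeCounting', Nat.add_sub_cancel]
          rw [Nat.count_succ, Nat.count_succ]
          have : ¬ (Nat.Prime (k + 1) ∧ Nat.Prime (k + 2)) := by
            rintro ⟨h1, h2⟩
            have := h1.eq_two_or_odd
            have := h2.eq_two_or_odd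
            omega
          split_ifs <;> first | omega | (exfalso; tauto)
        omega
  have : (2 : ℝ) * Nat.primeCounting m ≤ m := by exact_mod_cast h'
  linarith

open Real in
theorem rpow_le_card_primes_Ioc_self_sq {n : ℕ} (hn : 8 ≤ n) :
    (n : ℝ) ^ (((1 : ℕ) : ℝ) - log ((1 : ℕ) : ℝ) / 2) ≤
      ((Finset.Ioc (n ^ 1) (n ^ (1 + 1))).filter Nat.Prime).card := by
  rcases Nat.lt_or_ge n 13 with h | h
  · have hsub : n ≤ ((Finset.Ioc (n ^ 1) (n ^ (1 + 1))).filter Nat.Prime).card := by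
      have hmem : ({13, 17, 19, 23, 29, 31, 37, 41, 43, 47, 53, 59, 61} : Finset ℕ) ⊆
          (Finset.Ioc (n ^ 1) (n ^ (1 + 1))).filter Nat.Prime := by
        have : 8 ^ 2 ≤ n ^ 2 := Nat.pow_le_pow_left hn 2
        intro p hp
        simp only [Finset.mem_insert, Finset.mem_singleton] at hp
        simp only [Finset.mem_filter, Finset.mem_Ioc, pow_one, Nat.reduceAdd]
        refine ⟨⟨by omega, by omega⟩, ?_⟩
        rcases hp with rfl | rfl | rfl | rfl | rfl | rfl | rfl | rfl | rfl | rfl | rfl | rfl | rfl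
          <;> norm_num
      have := Finset.card_le_card hmem
      have hcard : ({13, 17, 19, 23, 29, 31, 37, 41, 43, 47, 53, 59, 61} : Finset ℕ).card = 13 := by
        decide
      omega
    simpa using (Nat.cast_le (α := ℝ)).2 hsub
  · refine rpow_le_card_primes_of_primeCounting_le hn le_rfl ?_
    have hn' : (13 : ℝ) ≤ n := by exact_mod_cast h
    have hpi := primeCounting_le_half hn
    have hlog := log_le_div_sixteen_add (show (0 : ℝ) < n by linarith)
    have hl := log_two_gt_d9
    have hl' := log_two_lt_d9
    have hlog0 : 0 ≤ log n := log_natCast_nonneg n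
    simp only [pow_one, Nat.cast_one, div_one]
    calc (1 + 1) * log n * (n + 2 + Nat.primeCounting n)
        ≤ (1 + 1) * log n * (n * (3 / 2 + 2 / 13)) := by
          gcongr
          linarith
      _ = n * (43 / 13 * log n) := by ring
      _ ≤ n * (n * log 2) := by
          refine mul_le_mul_of_nonneg_left ?_ (by positivity)
          nlinarith
      _ = n * n * log 2 := by ring

open Real in
theorem rpow_le_card_primes_Ioc_sq_cube {n : ℕ} (hn : 8 ≤ n) :
    (n : ℝ) ^ (((2 : ℕ) : ℝ) - log ((2 : ℕ) : ℝ) / 2) ≤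
      ((Finset.Ioc (n ^ 2) (n ^ (2 + 1))).filter Nat.Prime).card := by
  have hl := log_two_gt_d9
  have hl' := log_two_lt_d9
  refine rpow_le_card_primes_of_primeCounting_le hn (by norm_num) ?_
  have hlog := log_le_div_eight_add (show (0 : ℝ) < n by exact_mod_cast (by omega : 0 < n))
  have hlog0 : 0 ≤ log n := log_natCast_nonneg n
  rcases hn.eq_or_lt with rfl | h
  · have hpi : Nat.primeCounting (8 ^ 2) = 18 := by decide
    rw [hpi]
    push_cast at hlog ⊢
    nlinarith
  · have hn' : (9 : ℝ) ≤ n := by exact_mod_cast h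
    have hpi := primeCounting_le_div_three_add (m := n ^ 2) (by nlinarith)
    push_cast at hpi ⊢
    calc ((2 : ℝ) + 1) * log n * (n ^ 2 / 2 + 2 + Nat.primeCounting (n ^ 2))
        ≤ (2 + 1) * log n * (n ^ 2 * (5 / 6 + 5 / 81)) := by
          gcongr
          nlinarith
      _ = n ^ 2 * (3 * (5 / 6 + 5 / 81) * log n) := by ring
      _ ≤ n ^ 2 * (n * log 2) := by
          refine mul_le_mul_of_nonneg_left ?_ (by positivity)
          nlinarith
      _ = n * n ^ 2 * log 2 := by ring

open Real in
theorem rpow_le_card_primes_of_three_le_of_le_four {n d : ℕ} (hn : 8 ≤ n) (hd : 3 ≤ d)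
    (hd4 : d ≤ 4) :
    (n : ℝ) ^ ((d : ℝ) - log d / 2) ≤
      ((Finset.Ioc (n ^ d) (n ^ (d + 1))).filter Nat.Prime).card := by
  have hl := log_two_gt_d9
  have hl' := log_two_lt_d9
  refine rpow_le_card_primes_of_primeCounting_le hn (by omega) ?_
  have hn' : (8 : ℝ) ≤ n := by exact_mod_cast hn
  have hlog := log_le_div_eight_add (show (0 : ℝ) < n by linarith)
  have hlog0 : 0 ≤ log n := log_natCast_nonneg n
  have hpow : 8 ^ d ≤ n ^ d := Nat.pow_le_pow_left hn d
  have hpow' : (8 : ℝ) ^ d ≤ (n : ℝ) ^ d := by exact_mod_cast hpow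
  have hpi := primeCounting_le_four_div_fifteen_mul_add (m := n ^ d)
    (le_trans (by interval_cases d <;> norm_num) hpow)
  push_cast at hpi
  set M : ℝ := (n : ℝ) ^ d
  have key : (d + 1 : ℝ) * (1 / d + 4 / 15 + 20 / 8 ^ d) ≤ 2.61 := by
    interval_cases d <;> norm_num
  have hM0 : 0 ≤ M := by positivity
  calc ((d : ℝ) + 1) * log n * (M / d + 2 + Nat.primeCounting (n ^ d))
      ≤ (d + 1) * log n * (M * (1 / d + 4 / 15 + 20 / 8 ^ d)) := by
        gcongr
        have : 20 ≤ M * (20 / 8 ^ d) := by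
          rw [mul_div_assoc', le_div_iff₀ (by positivity)]
          linarith
        have : M * (1 / d + 4 / 15 + 20 / 8 ^ d) = M / d + 4 / 15 * M + M * (20 / 8 ^ d) := by
          ring
        linarith
    _ = M * ((d + 1) * (1 / d + 4 / 15 + 20 / 8 ^ d) * log n) := by ring
    _ ≤ M * (2.61 * log n) := by gcongr
    _ ≤ M * (n * log 2) := by
        refine mul_le_mul_of_nonneg_left ?_ hM0
        nlinarith
    _ = n * M * log 2 := by ring

open Real in
theorem rpow_le_card_primes_of_five_le {n d : ℕ} (hn : 8 ≤ n) (hd : 5 ≤ d) :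
    (n : ℝ) ^ ((d : ℝ) - log d / 2) ≤
      ((Finset.Ioc (n ^ d) (n ^ (d + 1))).filter Nat.Prime).card := by
  have hl := log_two_gt_d9
  have hl' := log_two_lt_d9
  refine rpow_le_card_primes_of_primeCounting_le hn (by omega) ?_
  have hn' : (8 : ℝ) ≤ n := by exact_mod_cast hn
  have hd' : (5 : ℝ) ≤ d := by exact_mod_cast hd
  have hlog := log_le_div_eight_add (show (0 : ℝ) < n by linarith)
  have hlog0 : 0 < log n := log_pos (by linarith)
  have hM8 : (8 : ℝ) ^ d ≤ (n : ℝ) ^ d := by gcongr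
  have hM1 : (1 : ℝ) < (n : ℝ) ^ d := one_lt_pow₀ (by linarith) (by omega)
  have hpi := primeCounting_le_rpow_two_thirds_add hM1
  rw [log_pow, show ⌊(n : ℝ) ^ d⌋₊ = n ^ d by exact_mod_cast Nat.floor_natCast (n ^ d)] at hpi
  set M : ℝ := (n : ℝ) ^ d
  have hM0 : 0 < M := by linarith
  have h2d : 6 * (2 : ℝ) ^ d ≥ 32 * (d + 1) := by
    have : ∀ k : ℕ, 5 ≤ k → 32 * (k + 1) ≤ 6 * 2 ^ k := by
      intro k hk
      induction k, hk using Nat.le_induction with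
      | base => norm_num
      | succ k hk ih => rw [pow_succ]; omega
    exact_mod_cast this d hd
  have h8d : (8 : ℝ) ^ d ≥ 1024 * 2 ^ d := by
    have h4 : (4 : ℝ) ^ 5 ≤ 4 ^ d := pow_le_pow_right₀ (by norm_num) hd
    rw [show (8 : ℝ) = 4 * 2 by norm_num, mul_pow]
    gcongr
    linarith
  have hroot : (d + 1) * M ^ (2 / 3 : ℝ) ≤ 6 / 32 * M := by
    have h1 : (2 : ℝ) ^ d ≤ M ^ (1 / 3 : ℝ) := by
      calc (2 : ℝ) ^ d = ((8 : ℝ) ^ d) ^ (1 / 3 : ℝ) := by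
            rw [show (8 : ℝ) = 2 ^ 3 by norm_num, ← pow_mul, mul_comm 3 d, pow_mul,
              ← rpow_natCast _ 3, ← rpow_mul (by positivity)]
            norm_num
        _ ≤ M ^ (1 / 3 : ℝ) := rpow_le_rpow (by positivity) hM8 (by norm_num)
    have h2 : M ^ (1 / 3 : ℝ) * M ^ (2 / 3 : ℝ) = M := by
      rw [← rpow_add hM0]; norm_num
    have h3 : 0 ≤ M ^ (2 / 3 : ℝ) := by positivity
    nlinarith [mul_le_mul_of_nonneg_right h1 h3, mul_le_mul_of_nonneg_right h2d h3]
  have hlin : (d + 1) * 2 ≤ 6 / 16384 * M := by linarith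
  have hdd : (d + 1 : ℝ) / d ≤ 6 / 5 := by
    rw [div_le_div_iff₀ (by linarith) (by norm_num)]; linarith
  calc ((d : ℝ) + 1) * log n * (M / d + 2 + Nat.primeCounting (n ^ d))
      ≤ (d + 1) * log n * (M / d + 2 + (M ^ (2 / 3 : ℝ) + 3 * log 2 * M / (d * log n))) := by
        gcongr
    _ = (d + 1) / d * (M * (log n + 3 * log 2)) +
        log n * ((d + 1) * 2 + (d + 1) * M ^ (2 / 3 : ℝ)) := by
        field_simp
        ring
    _ ≤ 6 / 5 * (M * (log n + 3 * log 2)) + log n * (6 / 16384 * M + 6 / 32 * M) := by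
        gcongr
    _ = M * (6 / 5 * (log n + 3 * log 2) + (6 / 16384 + 6 / 32) * log n) := by ring
    _ ≤ M * (n * log 2) := by
        refine mul_le_mul_of_nonneg_left ?_ hM0.le
        nlinarith
    _ = n * M * log 2 := by ring

theorem stmt_19 (n d : ℕ) (hn : 8 ≤ n) (hd : 1 ≤ d) :
    (n : ℝ) ^ ((d : ℝ) - Real.log d / 2) ≤
      ((Finset.Ioc (n ^ d) (n ^ (d + 1))).filter Nat.Prime).card := by
  rcases Nat.lt_or_ge d 5 with h | h
  · rcases Nat.lt_or_ge d 3 with h3 | h3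
    · interval_cases d
      · exact rpow_le_card_primes_Ioc_self_sq hn
      · exact rpow_le_card_primes_Ioc_sq_cube hn
    · exact rpow_le_card_primes_of_three_le_of_le_four hn h3 (by omega)
  · exact rpow_le_card_primes_of_five_le hn h
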